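/- Let F_1, …, F_U : E → ℝ (U ≥ 1) each be differentiable, convex, and L-smooth (L > 0), define the global objective F(w) = (1/U)∑_{u=1}^U F_u(w), let θ* be a minimizer of F, and assume the bounded-heterogeneity condition (1/U)∑_{u=1}^U ‖∇F_u(θ*)‖² ≤ σ*². Then for every θ ∈ E, every τ ≥ 1, and every family of points x_{u,k} ∈ E (u = 1, …, U, k = 0, …, τ−1): (1/U)·∑_{u=1}^U ∑_{k=0}^{τ−1} ‖∇F_u(x_{u,k})‖² ≤ (3L²/U)·∑_{u=1}^U ∑_{k=0}^{τ−1} ‖x_{u,k} − θ‖² + 6τL·(F(θ) − F(θ*)) + 3τσ*². -/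

import Mathlib

open RealInnerProductSpace

/-- The derivative of a differentiable function along a line, in terms of its gradient. -/
theorem hasDerivAt_comp_add_smul_gradient {E : Type*} [NormedAddCommGroup E]
    [InnerProductSpace ℝ E] [CompleteSpace E] {f : E → ℝ} (hf : Differentiable ℝ f)
    (x d : E) (t : ℝ) :
    HasDerivAt (fun s : ℝ => f (x + s • d)) (inner ℝ (gradient f (x + t • d)) d) t := by
  have h1 := (hf (x + t • d)).hasFDerivAt
  have h2 : HasDerivAt (fun s : ℝ => x + s • d) d t := by
    simpa using ((hasDerivAt_id t).smul_const d).const_add x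
  rw [inner_gradient_left]
  exact h1.comp_hasDerivAt t h2

/-- The quadratic upper bound for a function with Lipschitz gradient. -/
theorem le_add_inner_gradient_add_sq {E : Type*} [NormedAddCommGroup E]
    [InnerProductSpace ℝ E] [CompleteSpace E] {f : E → ℝ} (hf : Differentiable ℝ f) {L : ℝ}
    (hL : ∀ x y : E, ‖gradient f x - gradient f y‖ ≤ L * ‖x - y‖) (x d : E) :
    f (x + d) ≤ f x + inner ℝ (gradient f x) d + L / 2 * ‖d‖ ^ 2 := by
  have hder (t : ℝ) : HasDerivAt
      (fun s : ℝ => f (x + s • d) - s * inner ℝ (gradient f x) d - s ^ 2 * (L / 2 * ‖d‖ ^ 2))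
      (inner ℝ (gradient f (x + t • d)) d - inner ℝ (gradient f x) d - t * (L * ‖d‖ ^ 2)) t := by
    refine (((hasDerivAt_comp_add_smul_gradient hf x d t).sub
      ((hasDerivAt_id t).mul_const (inner ℝ (gradient f x) d))).sub
      ((hasDerivAt_pow 2 t).mul_const (L / 2 * ‖d‖ ^ 2))).congr_deriv ?_
    push_cast
    ring
  have hanti := antitoneOn_of_deriv_nonpos (convex_Icc (0 : ℝ) 1)
    (fun t _ => (hder t).continuousAt.continuousWithinAt)
    (fun t _ => (hder t).differentiableAt.differentiableWithinAt)
    (fun t ht => by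
      rw [(hder t).deriv, ← inner_sub_left]
      have ht0 : 0 < t := by rw [interior_Icc] at ht; exact ht.1
      have h1 := real_inner_le_norm (gradient f (x + t • d) - gradient f x) d
      have h2 := hL (x + t • d) x
      rw [add_sub_cancel_left, norm_smul, Real.norm_of_nonneg ht0.le] at h2
      nlinarith [mul_le_mul_of_nonneg_right h2 (norm_nonneg d)])
  have h := hanti (Set.left_mem_Icc.2 zero_le_one) (Set.right_mem_Icc.2 zero_le_one) zero_le_one
  norm_num at h
  rw [inner_gradient_left]
  linarith

/-- A differentiable convex function lies above its tangent hyperplanes. -/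
theorem ConvexOn.add_inner_gradient_le {E : Type*} [NormedAddCommGroup E]
    [InnerProductSpace ℝ E] [CompleteSpace E] {f : E → ℝ} (hc : ConvexOn ℝ Set.univ f)
    (hf : Differentiable ℝ f) (x d : E) :
    f x + inner ℝ (gradient f x) d ≤ f (x + d) := by
  have hconv : ConvexOn ℝ Set.univ (fun s : ℝ => f (x + s • d)) := by
    refine ⟨convex_univ, fun s _ t _ a b ha hb hab => ?_⟩
    have h := hc.2 (Set.mem_univ (x + s • d)) (Set.mem_univ (x + t • d)) ha hb hab
    convert h using 2
    have : x = (a + b) • x := by rw [hab, one_smul]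
    nth_rewrite 1 [this]
    simp only [smul_eq_mul]
    module
  have h := hconv.le_slope_of_hasDerivAt (Set.mem_univ 0) (Set.mem_univ 1) zero_lt_one
    (hasDerivAt_comp_add_smul_gradient hf x d 0)
  simp only [slope_def_field, zero_smul, one_smul, add_zero, sub_zero, div_one] at h
  linarith

/-- Cocoercivity: for a convex `L`-smooth function, the squared gradient gap is controlled by the
Bregman divergence. -/
theorem ConvexOn.norm_gradient_sub_sq_le {E : Type*} [NormedAddCommGroup E]
    [InnerProductSpace ℝ E] [CompleteSpace E] {f : E → ℝ} (hc : ConvexOn ℝ Set.univ f)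
    (hf : Differentiable ℝ f) {L : ℝ} (hL : 0 < L)
    (hsmooth : ∀ x y : E, ‖gradient f x - gradient f y‖ ≤ L * ‖x - y‖) (x y : E) :
    ‖gradient f x - gradient f y‖ ^ 2 ≤
      2 * L * (f x - f y - inner ℝ (gradient f y) (x - y)) := by
  set g := gradient f x - gradient f y with hg
  have h1 := le_add_inner_gradient_add_sq hf hsmooth x (-(L⁻¹ • g))
  have h2 := hc.add_inner_gradient_le hf y ((x - y) + -(L⁻¹ • g))
  rw [show y + ((x - y) + -(L⁻¹ • g)) = x + -(L⁻¹ • g) by abel, inner_add_right] at h2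
  have h3 : inner ℝ (gradient f x) g - inner ℝ (gradient f y) g = ‖g‖ ^ 2 := by
    rw [← inner_sub_left, ← hg, real_inner_self_eq_norm_sq]
  rw [inner_neg_right, real_inner_smul_right] at h1 h2
  rw [norm_neg, norm_smul, mul_pow, Real.norm_of_nonneg (inv_nonneg.2 hL.le)] at h1
  have h4 : L / 2 * (L⁻¹ ^ 2 * ‖g‖ ^ 2) = L⁻¹ * ‖g‖ ^ 2 / 2 := by field_simp
  have h5 : L⁻¹ * ‖g‖ ^ 2 ≤ 2 * (f x - f y - inner ℝ (gradient f y) (x - y)) := by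
    rw [h4, ← h3] at h1
    rw [← h3]
    linarith
  rw [inv_mul_le_iff₀ hL] at h5
  linarith

/-- At a minimizer of a sum of differentiable functions, the gradients sum to zero. -/
theorem sum_gradient_eq_zero_of_isLocalMin {E ι : Type*} [NormedAddCommGroup E]
    [InnerProductSpace ℝ E] [CompleteSpace E] (s : Finset ι) {F : ι → E → ℝ}
    (hF : ∀ i ∈ s, Differentiable ℝ (F i)) {z : E} (hz : IsLocalMin (fun w => ∑ i ∈ s, F i w) z) :
    ∑ i ∈ s, gradient (F i) z = 0 := by
  have h := hz.hasFDerivAt_eq_zero (HasFDerivAt.fun_sum fun i hi => (hF i hi z).hasFDerivAt)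
  simp only [gradient, ← map_sum, h, map_zero]

theorem norm_sq_le_three_mul {E : Type*} [SeminormedAddCommGroup E] (a b c : E) :
    ‖a‖ ^ 2 ≤ 3 * (‖a - b‖ ^ 2 + ‖b - c‖ ^ 2 + ‖c‖ ^ 2) := by
  have h : ‖a‖ ≤ ‖a - b‖ + ‖b - c‖ + ‖c‖ := by
    simpa using norm_add₃_le (a := a - b) (b := b - c) (c := c)
  have h2 := pow_le_pow_left₀ (norm_nonneg a) h 2
  nlinarith [sq_nonneg (‖a - b‖ - ‖b - c‖), sq_nonneg (‖b - c‖ - ‖c‖), sq_nonneg (‖a - b‖ - ‖c‖)]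

/-- Bounding client aggregate gradients: the average of the squared client gradient norms is
bounded by the client drift, the global objective gap, and the heterogeneity at the optimum. -/
theorem client_grad_sq_bound {E : Type*} [NormedAddCommGroup E]
    [InnerProductSpace ℝ E] [CompleteSpace E]
    (U : ℕ) (hU : 1 ≤ U) (F : Fin U → E → ℝ) (L : ℝ) (hL : 0 < L)
    (hdiff : ∀ u, Differentiable ℝ (F u))
    (hconv : ∀ u, ConvexOn ℝ Set.univ (F u))
    (hsmooth : ∀ u, ∀ x y : E, ‖gradient (F u) x - gradient (F u) y‖ ≤ L * ‖x - y‖)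
    (Fglob : E → ℝ) (hFglob : ∀ w : E, Fglob w = (1 / (U : ℝ)) * ∑ u : Fin U, F u w)
    (θstar : E) (hmin : ∀ θ : E, Fglob θstar ≤ Fglob θ)
    (σstar : ℝ)
    (hhet : (1 / (U : ℝ)) * ∑ u : Fin U, ‖gradient (F u) θstar‖ ^ 2 ≤ σstar ^ 2)
    (θ : E) (τ : ℕ) (hτ : 1 ≤ τ) (x : Fin U → ℕ → E) :
    (1 / (U : ℝ)) * ∑ u : Fin U, ∑ k ∈ Finset.range τ, ‖gradient (F u) (x u k)‖ ^ 2 ≤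
      (3 * L ^ 2 / (U : ℝ)) * ∑ u : Fin U, ∑ k ∈ Finset.range τ, ‖x u k - θ‖ ^ 2 +
        6 * (τ : ℝ) * L * (Fglob θ - Fglob θstar) + 3 * (τ : ℝ) * σstar ^ 2 := by
  have hU0 : (0 : ℝ) < U := by exact_mod_cast hU
  have hzero : ∑ u, gradient (F u) θstar = 0 := by
    refine sum_gradient_eq_zero_of_isLocalMin _ (fun u _ => hdiff u) (Filter.Eventually.of_forall ?_)
    intro w
    have h := hmin w
    rw [hFglob, hFglob] at h
    exact le_of_mul_le_mul_left h (by positivity)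
  have hpoint (u : Fin U) (k : ℕ) : ‖gradient (F u) (x u k)‖ ^ 2 ≤
      3 * L ^ 2 * ‖x u k - θ‖ ^ 2 +
        (6 * L * (F u θ - F u θstar - inner ℝ (gradient (F u) θstar) (θ - θstar)) +
          3 * ‖gradient (F u) θstar‖ ^ 2) := by
    have h1 := norm_sq_le_three_mul (gradient (F u) (x u k)) (gradient (F u) θ)
      (gradient (F u) θstar)
    have h2 := (hconv u).norm_gradient_sub_sq_le (hdiff u) hL (hsmooth u) θ θstar
    have h3 := pow_le_pow_left₀ (norm_nonneg _) (hsmooth u (x u k) θ) 2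
    rw [mul_pow] at h3
    linarith
  have hsum := Finset.sum_le_sum fun u (_ : u ∈ Finset.univ) =>
    Finset.sum_le_sum fun k (_ : k ∈ Finset.range τ) => hpoint u k
  simp only [Finset.sum_add_distrib, Finset.sum_sub_distrib, ← Finset.mul_sum, Finset.sum_const,
    Finset.card_range, nsmul_eq_mul, ← sum_inner, hzero, inner_zero_left] at hsum
  have h1 := mul_le_mul_of_nonneg_left hsum (one_div_nonneg.2 hU0.le)
  have h2 := mul_le_mul_of_nonneg_left hhet (show (0 : ℝ) ≤ 3 * τ by positivity)
  rw [hFglob θ, hFglob θstar]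
  calc _ ≤ _ := h1
    _ = 3 * L ^ 2 / (U : ℝ) * ∑ u : Fin U, ∑ k ∈ Finset.range τ, ‖x u k - θ‖ ^ 2 +
        6 * (τ : ℝ) * L * (1 / (U : ℝ) * ∑ u, F u θ - 1 / (U : ℝ) * ∑ u, F u θstar) +
        3 * τ * (1 / (U : ℝ) * ∑ u, ‖gradient (F u) θstar‖ ^ 2) := by ring
    _ ≤ _ := by gcongr
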